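/- Assume (H0), (H1) and (H2) hold for V with parameters D, C, s, let δ_n = n^{−α} with 0 < α ≤ 1, and let a^{(1)},…,a^{(k)} be variation sequences each of order greater than D + s/2 + 1/4. For each n, let (Δ^{(p)}_i)_{p=1..k, i=1..n−L(a^{(p)})+1} be jointly centered Gaussian random variables with Cov(Δ^{(p)}_i, Δ^{(q)}_{i'}) = −Σ_m (a^{(p)}*a^{(q)})_m V((i−i'+m)δ_n) (the corresponding block covariance matrix being assumed positive semidefinite), and set V_{a^{(p)},n} = Σ_i (Δ^{(p)}_i)². Assume that the k×k matrix with (p,q) entry (1/(n δ_n^{4D+2s})) Cov(V_{a^{(p)},n}, V_{a^{(q)},n}) converges as n → ∞ to an invertible matrix Λ_∞. Then the random vector with coordinates (V_{a^{(p)},n} − E[V_{a^{(p)},n}]) / (n^{1/2} δ_n^{2D+s}), p = 1,…,k, converges in distribution to the centered Gaussian distribution N(0, Λ_∞) on ℝ^k. -/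

import Mathlib

open Filter MeasureTheory ProbabilityTheory Matrix

/-- Convolution of finitely supported sequences: `(a*a')_m = Σ_{k-l=m} a_k a'_l`. -/
noncomputable def seqConv (a a' : ℤ → ℝ) (m : ℤ) : ℝ := ∑ᶠ k : ℤ, a k * a' (k - m)

/-- The law of the centered Gaussian vector `A G` with `G` a vector of i.i.d. standard
normal variables. -/
noncomputable def gaussVec {ι : Type*} [Fintype ι] (A : Matrix ι ι ℝ) : Measure (ι → ℝ) :=
  Measure.map A.mulVec (Measure.pi fun _ => gaussianReal 0 1)

/-- The quadratic `a^{(p)}`-variation `V_{a^{(p)},n} = Σ_{i=1}^{n−L_p+1} (Δ^{(p)}_i)²`. -/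
noncomputable def quadVarP (k n : ℕ) (Ls : Fin k → ℕ) (p : Fin k)
    (z : Fin k × Fin n → ℝ) : ℝ :=
  ∑ i : Fin n, if (i : ℕ) + Ls p ≤ n then (z (p, i)) ^ 2 else 0

/-- Expectation of `V_{a^{(p)},n}`. -/
noncomputable def expVP (k n : ℕ) (Ls : Fin k → ℕ)
    (A : Matrix (Fin k × Fin n) (Fin k × Fin n) ℝ) (p : Fin k) : ℝ :=
  ∫ z, quadVarP k n Ls p z ∂(gaussVec A)

/-- Covariance of `V_{a^{(p)},n}` and `V_{a^{(q)},n}`. -/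
noncomputable def covVP (k n : ℕ) (Ls : Fin k → ℕ)
    (A : Matrix (Fin k × Fin n) (Fin k × Fin n) ℝ) (p q : Fin k) : ℝ :=
  ∫ z, (quadVarP k n Ls p z - expVP k n Ls A p) * (quadVarP k n Ls q z - expVP k n Ls A q)
    ∂(gaussVec A)

/-- A standard Gaussian quadratic form has the law of a weighted sum of squares, the weights being
the eigenvalues. -/
theorem map_quadForm_eq_map_eigenvalues {ι : Type*} [Fintype ι] [DecidableEq ι]
    {S : Matrix ι ι ℝ} (hS : S.IsHermitian) :
    (Measure.pi fun _ : ι => gaussianReal 0 1).map (fun x => x ⬝ᵥ S *ᵥ x)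
      = (Measure.pi fun _ : ι => gaussianReal 0 1).map
          (fun x => ∑ i, hS.eigenvalues i * x i ^ 2) := by
  set b := hS.eigenvectorBasis with hb
  have h := (map_pi_eq_stdGaussian (ι := ι)).trans (stdGaussian_eq_map_pi_orthonormalBasis b)
  have hq : Measurable fun y : EuclideanSpace ℝ ι => y.ofLp ⬝ᵥ S *ᵥ y.ofLp := by
    unfold dotProduct mulVec dotProduct
    fun_prop
  have h2 := congrArg (Measure.map fun y : EuclideanSpace ℝ ι => y.ofLp ⬝ᵥ S *ᵥ y.ofLp) h
  rw [Measure.map_map hq (by fun_prop), Measure.map_map hq (by fun_prop)] at h2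
  refine h2.trans ?_
  congr 1
  funext x
  have h3 : S *ᵥ (∑ i, x i • b i : EuclideanSpace ℝ ι).ofLp
      = (∑ i, (hS.eigenvalues i * x i) • b i : EuclideanSpace ℝ ι).ofLp := by
    rw [WithLp.ofLp_sum, WithLp.ofLp_sum, Matrix.mulVec_sum]
    refine Finset.sum_congr rfl fun i _ => ?_
    rw [WithLp.ofLp_smul, WithLp.ofLp_smul, Matrix.mulVec_smul, hb, hS.mulVec_eigenvectorBasis,
      smul_smul, mul_comm]
  have h4 : ∀ y z : EuclideanSpace ℝ ι, y.ofLp ⬝ᵥ z.ofLp = inner ℝ z y := by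
    intro y z
    simp [EuclideanSpace.inner_eq_star_dotProduct]
  simp only [Function.comp_apply]
  rw [h3, h4, b.orthonormal.inner_sum]
  simp
  exact Finset.sum_congr rfl fun i _ => by ring

theorem norm_prod_sub_prod_le_sum {ι : Type*} (s : Finset ι) (a b : ι → ℂ)
    (ha : ∀ i, ‖a i‖ ≤ 1) (hb : ∀ i, ‖b i‖ ≤ 1) :
    ‖∏ i ∈ s, a i - ∏ i ∈ s, b i‖ ≤ ∑ i ∈ s, ‖a i - b i‖ := by
  classical
  induction s using Finset.induction_on with
  | empty => simp
  | insert j s hj ih =>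
    rw [Finset.prod_insert hj, Finset.prod_insert hj, Finset.sum_insert hj]
    have h1 : a j * ∏ i ∈ s, a i - b j * ∏ i ∈ s, b i
        = (a j - b j) * ∏ i ∈ s, a i + b j * (∏ i ∈ s, a i - ∏ i ∈ s, b i) := by ring
    have h2 : ‖∏ i ∈ s, a i‖ ≤ 1 := by
      rw [norm_prod]
      exact Finset.prod_le_one (fun _ _ => norm_nonneg _) fun i _ => ha i
    rw [h1]
    refine (norm_add_le _ _).trans ?_
    rw [norm_mul, norm_mul]
    refine add_le_add (mul_le_of_le_one_right (norm_nonneg _) h2) ?_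
    exact (mul_le_of_le_one_left (norm_nonneg _) (hb j)).trans ih

/-- The characteristic function of a centered law of variance `v` agrees to second order with
that of `N(0, v)`. -/
theorem charFun_sub_exp_isLittleO (ν : Measure ℝ) [IsProbabilityMeasure ν] (hν : MemLp id 2 ν)
    (h0 : ∫ y, y ∂ν = 0) :
    (fun u : ℝ => charFun ν u - Complex.exp (-((∫ y, y ^ 2 ∂ν : ℝ) * u ^ 2 / 2 : ℝ)))
      =o[nhds 0] fun u : ℝ => u ^ 2 := by
  have key : ∀ μ : Measure ℝ, IsProbabilityMeasure μ → MemLp id 2 μ → ∫ y, y ∂μ = 0 →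
      (fun u : ℝ => charFun μ u - (1 - ((∫ y, y ^ 2 ∂μ : ℝ) * u ^ 2 / 2 : ℝ)))
      =o[nhds 0] fun u : ℝ => u ^ 2 := by
    intro μ _ hμ hμ0
    have := taylor_isLittleO_univ (x₀ := 0) (n := 2) (contDiff_charFun hμ)
    simp only [sub_zero] at this
    refine this.congr_left fun u => ?_
    rw [taylorWithinEval_charFun_zero (by exact_mod_cast hμ)]
    simp [Finset.sum_range_succ, hμ0]
    have hI : (Complex.I)^2 = -1 := Complex.I_sq
    linear_combination ((2⁻¹ * (u:ℂ)^2 * (∫ y, y ^ 2 ∂μ : ℝ))) * hI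
  have hg := key (gaussianReal 0 (∫ y, y ^ 2 ∂ν).toNNReal) inferInstance
    (memLp_id_gaussianReal' 2 (by simp)) integral_id_gaussianReal
  have hv : 0 ≤ ∫ y, y ^ 2 ∂ν := integral_nonneg fun y => sq_nonneg y
  have hvar : ∫ y, y ^ 2 ∂(gaussianReal 0 (∫ y, y ^ 2 ∂ν).toNNReal) = ∫ y, y ^ 2 ∂ν := by
    have h := variance_id_gaussianReal (μ := 0) (v := (∫ y, y ^ 2 ∂ν).toNNReal)
    rw [variance_of_integral_eq_zero aemeasurable_id integral_id_gaussianReal] at h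
    simpa [hv] using h
  have hd := (key ν inferInstance hν h0).sub hg
  rw [hvar] at hd
  refine hd.congr_left fun u => ?_
  rw [charFun_gaussianReal]
  simp [hv]

theorem tendsto_prod_charFun (ν : Measure ℝ) [IsProbabilityMeasure ν] (hν : MemLp id 2 ν)
    (h0 : ∫ y, y ∂ν = 0) (hpos : 0 < ∫ y, y ^ 2 ∂ν) {ι : ℕ → Type*} [∀ n, Fintype (ι n)]
    (σ : ∀ n, ι n → ℝ) {ρ : ℕ → ℝ} (hρ : Tendsto ρ atTop (nhds 0))
    (hσ : ∀ᶠ n in atTop, ∀ l, |σ n l| ≤ ρ n) {τ : ℝ}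
    (hτ : Tendsto (fun n => (∫ y, y ^ 2 ∂ν) * ∑ l, σ n l ^ 2) atTop (nhds τ)) :
    Tendsto (fun n => ∏ l, charFun ν (σ n l)) atTop (nhds (Complex.exp (-(τ / 2 : ℝ)))) := by
  set v := ∫ y, y ^ 2 ∂ν with hv
  have hexp : Tendsto (fun n => ∏ l, Complex.exp (-(v * σ n l ^ 2 / 2 : ℝ))) atTop
      (nhds (Complex.exp (-(τ / 2 : ℝ)))) := by
    have : (fun n => ∏ l, Complex.exp (-(v * σ n l ^ 2 / 2 : ℝ)))
        = fun n => Complex.exp (-((v * ∑ l, σ n l ^ 2) / 2 : ℝ)) := by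
      funext n
      rw [← Complex.exp_sum, Finset.sum_neg_distrib, Finset.mul_sum, Finset.sum_div,
        Complex.ofReal_sum]
    rw [this]
    refine (Complex.continuous_exp.tendsto _).comp ?_
    refine Tendsto.neg ((Complex.continuous_ofReal.tendsto _).comp ?_)
    exact hτ.div_const 2
  have hdiff : Tendsto (fun n => ∏ l, charFun ν (σ n l)
      - ∏ l, Complex.exp (-(v * σ n l ^ 2 / 2 : ℝ))) atTop (nhds 0) := by
    rw [Metric.tendsto_nhds]
    intro ε hε
    set B := (|τ| + 1) / v with hB
    have hBpos : 0 < B := by positivity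
    have ho := charFun_sub_exp_isLittleO ν hν h0
    rw [Asymptotics.isLittleO_iff] at ho
    have ho' := ho (c := ε / (2 * B)) (by positivity)
    obtain ⟨η, hη, hη'⟩ := Metric.eventually_nhds_iff.1 ho'
    have hb : ∀ᶠ n in atTop, v * ∑ l, σ n l ^ 2 < |τ| + 1 :=
      hτ.eventually_lt_const ((le_abs_self τ).trans_lt (lt_add_one _))
    filter_upwards [hb, hσ, hρ.eventually_lt_const hη] with n hn1 hn2 hn3
    rw [dist_zero_right]
    refine (norm_prod_sub_prod_le_sum _ _ _ (fun l => norm_charFun_le_one _) fun l => ?_).trans_lt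
      ?_
    · rw [Complex.norm_exp]
      simp only [Complex.neg_re, Complex.ofReal_re, Real.exp_le_one_iff, Left.neg_nonpos_iff]
      positivity
    · calc _ ≤ ∑ l, ε / (2 * B) * σ n l ^ 2 := by
            refine Finset.sum_le_sum fun l _ => ?_
            have := hη' (y := σ n l) (by
              rw [Real.dist_eq, sub_zero]; exact (hn2 l).trans_lt hn3)
            simpa using this
        _ = ε / (2 * B) * ∑ l, σ n l ^ 2 := by rw [Finset.mul_sum]
        _ ≤ ε / (2 * B) * B := by
            refine mul_le_mul_of_nonneg_left ?_ (by positivity)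
            rw [hB, le_div_iff₀ hpos, mul_comm]
            exact hn1.le
        _ < ε := by field_simp; linarith
  simpa using hdiff.add hexp


instance holderTriple_four_four_two : ENNReal.HolderTriple 4 4 2 where
  inv_add_inv_eq_inv := by
    rw [← ENNReal.toReal_eq_toReal_iff' (by simp) (by simp), ENNReal.toReal_add (by simp) (by simp)]
    norm_num

theorem memLp_sq_sub_gaussianReal (m : ℝ) :
    MemLp (fun x : ℝ => x ^ 2 - m) 2 (gaussianReal 0 1) := by
  have h4 : MemLp id 4 (gaussianReal 0 1) := memLp_id_gaussianReal' 4 (by simp)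
  have h := (h4.mul' h4 : MemLp (fun x : ℝ => id x * id x) 2 (gaussianReal 0 1))
  refine (h.sub (memLp_const m)).congr_norm (by fun_prop) ?_
  exact Eventually.of_forall fun x => by simp [pow_two]

theorem integral_sq_sub_pos_gaussianReal (m : ℝ) :
    0 < ∫ x, (x ^ 2 - m) ^ 2 ∂(gaussianReal 0 1) := by
  have hi : Integrable (fun x : ℝ => (x ^ 2 - m) ^ 2) (gaussianReal 0 1) :=
    (memLp_sq_sub_gaussianReal m).integrable_sq
  have := nullSingletonClass_gaussianReal (μ := 0) (v := 1) one_ne_zero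
  rw [integral_pos_iff_support_of_nonneg (fun x => sq_nonneg _) hi]
  have hsub : (Function.support fun x : ℝ => (x ^ 2 - m) ^ 2)ᶜ ⊆ {√m, -√m} := by
    intro x hx
    have hx' : x ^ 2 - m = 0 := by simpa using hx
    have hm : √m = |x| := by rw [← sub_eq_zero.1 hx', Real.sqrt_sq_eq_abs]
    rcases abs_choice x with h | h <;> simp [hm, h]
  have h0 : gaussianReal 0 1 (Function.support fun x : ℝ => (x ^ 2 - m) ^ 2)ᶜ = 0 :=
    measure_mono_null hsub (Set.Finite.measure_zero (by simp) _)
  rw [prob_compl_eq_zero_iff (by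
    exact measurableSet_support (by fun_prop))] at h0
  rw [h0]
  exact one_pos

/-- A quadratic form in i.i.d. standard Gaussian variables is square integrable. -/
theorem memLp_quadForm {ι : Type*} [Fintype ι] (S : Matrix ι ι ℝ) :
    MemLp (fun x : ι → ℝ => x ⬝ᵥ S *ᵥ x) 2 (Measure.pi fun _ : ι => gaussianReal 0 1) := by
  have h4 : ∀ i, MemLp (fun x : ι → ℝ => x i) 4 (Measure.pi fun _ : ι => gaussianReal 0 1) :=
    fun i => (memLp_id_gaussianReal' (μ := 0) (v := 1) 4 (by simp)).comp_measurePreserving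
      (measurePreserving_eval (fun _ : ι => gaussianReal 0 1) i)
  have h2 : ∀ i, MemLp (fun x : ι → ℝ => ∑ j, S i j * x j) 4
      (Measure.pi fun _ : ι => gaussianReal 0 1) :=
    fun i => memLp_finsetSum _ fun j _ => (h4 j).const_mul (S i j)
  exact memLp_finsetSum _ fun i _ => (h2 i).mul' (h4 i)

theorem integral_sq_sum_pi {ι : Type*} [Fintype ι] (μ : Measure ℝ) [IsProbabilityMeasure μ]
    {f : ℝ → ℝ} (hf : MemLp f 2 μ) (h0 : ∫ y, f y ∂μ = 0) (σ : ι → ℝ) :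
    ∫ x, (∑ i, σ i * f (x i)) ^ 2 ∂(Measure.pi fun _ : ι => μ)
      = (∫ y, f y ^ 2 ∂μ) * ∑ i, σ i ^ 2 := by
  have hev : ∀ i, MemLp (fun x : ι → ℝ => σ i * f (x i)) 2 (Measure.pi fun _ : ι => μ) :=
    fun i => (hf.comp_measurePreserving (measurePreserving_eval (fun _ : ι => μ) i)).const_mul _
  have hind : iIndepFun (fun i (x : ι → ℝ) => σ i * f (x i)) (Measure.pi fun _ : ι => μ) :=
    iIndepFun_pi (μ := fun _ => μ) (X := fun i y => σ i * f y)
      (fun i => (hf.1.aemeasurable).const_mul _)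
  have hz : ∀ i, ∫ x, σ i * f (x i) ∂(Measure.pi fun _ : ι => μ) = 0 := fun i => by
    rw [integral_const_mul, integral_comp_eval (μ := fun _ : ι => μ) (f := f) hf.1, h0, mul_zero]
  have hvar := IndepFun.variance_sum (s := Finset.univ) (fun i _ => hev i)
    (fun i _ j _ hij => hind.indepFun hij)
  rw [variance_of_integral_eq_zero] at hvar
  · simp only [Finset.sum_apply] at hvar
    rw [hvar, Finset.mul_sum]
    refine Finset.sum_congr rfl fun i _ => ?_
    rw [variance_of_integral_eq_zero (hev i).1.aemeasurable (hz i)]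
    simp_rw [mul_pow]
    rw [integral_const_mul, integral_comp_eval (μ := fun _ : ι => μ) (f := fun y => f y ^ 2)
      (hf.1.pow 2), mul_comm]
  · exact Finset.aemeasurable_sum _ fun i _ => (hev i).1.aemeasurable
  · simp only [Finset.sum_apply]
    rw [integral_finsetSum _ fun i _ => (hev i).integrable (by norm_num)]
    exact Finset.sum_eq_zero fun i _ => hz i

/-- Central limit theorem for quadratic forms in i.i.d. standard Gaussian variables: if the
eigenvalues are asymptotically negligible and the variances converge to `τ`, then the centered
forms converge to `N(0, τ)` (characteristic function at `1`). -/
theorem tendsto_integral_exp_quadForm {ι : ℕ → Type*} [∀ n, Fintype (ι n)]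
    [∀ n, DecidableEq (ι n)] {S : ∀ n, Matrix (ι n) (ι n) ℝ} (hS : ∀ n, (S n).IsHermitian)
    {ρ : ℕ → ℝ} (hρ : Tendsto ρ atTop (nhds 0))
    (hev : ∀ᶠ n in atTop, ∀ l, |(hS n).eigenvalues l| ≤ ρ n) {τ : ℝ}
    (hτ : Tendsto (fun n => ∫ x, (x ⬝ᵥ S n *ᵥ x
        - ∫ y, y ⬝ᵥ S n *ᵥ y ∂(Measure.pi fun _ : ι n => gaussianReal 0 1)) ^ 2
        ∂(Measure.pi fun _ : ι n => gaussianReal 0 1)) atTop (nhds τ)) :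
    Tendsto (fun n => ∫ x, Complex.exp (((x ⬝ᵥ S n *ᵥ x
        - ∫ y, y ⬝ᵥ S n *ᵥ y ∂(Measure.pi fun _ : ι n => gaussianReal 0 1) : ℝ) : ℂ) * Complex.I)
        ∂(Measure.pi fun _ : ι n => gaussianReal 0 1)) atTop
      (nhds (Complex.exp (-(τ / 2 : ℝ)))) := by
  set g := gaussianReal 0 1 with hg
  set m := ∫ x, x ^ 2 ∂g with hm
  set f : ℝ → ℝ := fun x => x ^ 2 - m with hf
  have hfL : MemLp f 2 g := memLp_sq_sub_gaussianReal m
  have hsq : Integrable (fun x : ℝ => x ^ 2) g := by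
    simpa using (memLp_sq_sub_gaussianReal 0).integrable (by norm_num)
  have hf0 : ∫ x, f x ∂g = 0 := by
    rw [hf, integral_sub hsq (integrable_const _)]
    simp [hm]
  have hfm : Measurable f := by fun_prop
  have hmean : ∀ n, ∫ y, y ⬝ᵥ S n *ᵥ y ∂(Measure.pi fun _ : ι n => g)
      = m * ∑ l, (hS n).eigenvalues l := by
    intro n
    have h := map_quadForm_eq_map_eigenvalues (hS n)
    have h' := congrArg (fun μ => ∫ t, t ∂μ) h
    simp only at h'
    rw [integral_map (memLp_quadForm (S n)).1.aemeasurable (by fun_prop),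
      integral_map (Measurable.aemeasurable (by fun_prop)) (by fun_prop), integral_finsetSum] at h'
    · rw [h', Finset.mul_sum]
      refine Finset.sum_congr rfl fun l _ => ?_
      rw [integral_const_mul, integral_comp_eval (μ := fun _ : ι n => gaussianReal 0 1)
        (f := fun y : ℝ => y ^ 2) (by fun_prop), mul_comm]
    · intro l _
      exact (integrable_comp_eval (μ := fun _ : ι n => gaussianReal 0 1)
        (f := fun y : ℝ => y ^ 2) hsq).const_mul _
  have hlaw : ∀ n, (Measure.pi fun _ : ι n => g).map (fun x => x ⬝ᵥ S n *ᵥ x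
        - ∫ y, y ⬝ᵥ S n *ᵥ y ∂(Measure.pi fun _ : ι n => g))
      = (Measure.pi fun _ : ι n => g).map (fun x => ∑ l, (hS n).eigenvalues l * f (x l)) := by
    intro n
    have h := congrArg (Measure.map fun t => t - m * ∑ l, (hS n).eigenvalues l)
      (map_quadForm_eq_map_eigenvalues (hS n))
    have hmq : Measurable fun x : ι n → ℝ => x ⬝ᵥ S n *ᵥ x := by
      unfold dotProduct mulVec dotProduct
      fun_prop
    rw [Measure.map_map (by fun_prop) hmq, Measure.map_map (by fun_prop) (by fun_prop)] at h
    rw [hmean n]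
    refine h.trans ?_
    congr 1
    funext x
    simp only [Function.comp_apply, hf, mul_sub, Finset.sum_sub_distrib, ← Finset.sum_mul]
    ring
  have hmq : ∀ n, AEMeasurable (fun x => x ⬝ᵥ S n *ᵥ x
      - ∫ y, y ⬝ᵥ S n *ᵥ y ∂(Measure.pi fun _ : ι n => g)) (Measure.pi fun _ : ι n => g) :=
    fun n => (memLp_quadForm (S n)).1.aemeasurable.sub_const _
  have hprob : IsProbabilityMeasure (g.map f) := Measure.isProbabilityMeasure_map hfm.aemeasurable
  have hv : ∫ y, y ^ 2 ∂(g.map f) = ∫ x, f x ^ 2 ∂g :=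
    integral_map hfm.aemeasurable (by fun_prop)
  have hprod : ∀ n, ∫ x, Complex.exp (((x ⬝ᵥ S n *ᵥ x
        - ∫ y, y ⬝ᵥ S n *ᵥ y ∂(Measure.pi fun _ : ι n => g) : ℝ) : ℂ) * Complex.I)
        ∂(Measure.pi fun _ : ι n => g) = ∏ l, charFun (g.map f) ((hS n).eigenvalues l) := by
    intro n
    have h := congrArg (fun μ => ∫ t : ℝ, Complex.exp ((t : ℂ) * Complex.I) ∂μ) (hlaw n)
    simp only at h
    rw [integral_map (hmq n) (by fun_prop),
      integral_map (Measurable.aemeasurable (by fun_prop)) (by fun_prop)] at h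
    rw [h]
    simp_rw [Complex.ofReal_sum, Finset.sum_mul, Complex.exp_sum]
    rw [integral_fintype_prod_eq_prod (f := fun (l : ι n) (y : ℝ) =>
      Complex.exp ((((hS n).eigenvalues l * f y : ℝ) : ℂ) * Complex.I))]
    refine Finset.prod_congr rfl fun l _ => ?_
    rw [charFun_apply_real, integral_map hfm.aemeasurable (by fun_prop)]
    push_cast
    rfl
  simp_rw [hprod]
  refine tendsto_prod_charFun (g.map f) ?_ ?_ ?_ _ hρ hev ?_
  · exact (memLp_map_measure_iff (by fun_prop) hfm.aemeasurable).2 hfL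
  · rw [integral_map hfm.aemeasurable (by fun_prop)]
    exact hf0
  · rw [hv]
    exact integral_sq_sub_pos_gaussianReal m
  · rw [hv]
    refine hτ.congr fun n => ?_
    rw [← integral_sq_sum_pi g hfL hf0]
    have h := congrArg (fun μ => ∫ t : ℝ, t ^ 2 ∂μ) (hlaw n)
    simp only at h
    rwa [integral_map (hmq n) (by fun_prop),
      integral_map (Measurable.aemeasurable (by fun_prop)) (by fun_prop)] at h

/-- The eigenvalues of `Aᵀ diag(w) A` are bounded by the row sums of `A Aᵀ diag(w)`. -/
theorem abs_eigenvalues_le_of_row_sum {ι : Type*} [Fintype ι] [DecidableEq ι]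
    (A : Matrix ι ι ℝ) (w : ι → ℝ) (hS : (Aᵀ * diagonal w * A).IsHermitian) {R : ℝ} (hR0 : 0 ≤ R)
    (hR : ∀ x, ∑ y, |(A * Aᵀ) x y| * |w y| ≤ R) (l : ι) : |hS.eigenvalues l| ≤ R := by
  set σ := hS.eigenvalues l with hσ
  set v : ι → ℝ := ⇑(hS.eigenvectorBasis l) with hv
  have hSv : (Aᵀ * diagonal w * A) *ᵥ v = σ • v := hS.mulVec_eigenvectorBasis l
  have hv0 : v ≠ 0 := fun h => hS.eigenvectorBasis.orthonormal.ne_zero l (by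
    ext i
    exact congrFun h i)
  set u := A *ᵥ v with hu
  by_cases hu0 : u = 0
  · have h1 : (Aᵀ * diagonal w * A) *ᵥ v = 0 := by
      rw [← Matrix.mulVec_mulVec, ← hu, hu0, Matrix.mulVec_zero]
    rw [h1] at hSv
    rcases smul_eq_zero.1 hSv.symm with h | h
    · rw [h, abs_zero]
      exact hR0
    · exact absurd h hv0
  have hMu : ∀ x, σ * u x = ∑ y, (A * Aᵀ) x y * w y * u y := by
    intro x
    have h1 : (A * Aᵀ * diagonal w) *ᵥ u = σ • u := by
      rw [hu, Matrix.mulVec_mulVec, ← Matrix.mulVec_smul, ← hSv, Matrix.mulVec_mulVec]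
      simp only [Matrix.mul_assoc]
    have h2 := congrFun h1 x
    rw [Pi.smul_apply, smul_eq_mul] at h2
    rw [← h2]
    simp [Matrix.mulVec, dotProduct, Matrix.mul_diagonal]
  obtain ⟨x0, hx0⟩ := Function.ne_iff.1 hu0
  obtain ⟨x, -, hx⟩ := Finset.exists_max_image Finset.univ (fun x => |u x|) ⟨x0, Finset.mem_univ _⟩
  have hux : 0 < |u x| := (abs_pos.2 hx0).trans_le (hx x0 (Finset.mem_univ _))
  refine le_of_mul_le_mul_right ?_ hux
  calc |σ| * |u x| = |∑ y, (A * Aᵀ) x y * w y * u y| := by rw [← abs_mul, hMu]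
    _ ≤ ∑ y, |(A * Aᵀ) x y * w y * u y| := Finset.abs_sum_le_sum_abs _ _
    _ ≤ ∑ y, |(A * Aᵀ) x y| * |w y| * |u x| := by
        refine Finset.sum_le_sum fun y _ => ?_
        rw [abs_mul, abs_mul]
        exact mul_le_mul_of_nonneg_left (hx y (Finset.mem_univ _)) (by positivity)
    _ = (∑ y, |(A * Aᵀ) x y| * |w y|) * |u x| := by rw [Finset.sum_mul]
    _ ≤ R * |u x| := mul_le_mul_of_nonneg_right (hR x) hux.le

theorem measurable_mulVec {ι : Type*} [Fintype ι] (A : Matrix ι ι ℝ) :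
    Measurable (A.mulVec) := by
  unfold mulVec dotProduct
  fun_prop

instance isProbabilityMeasure_gaussVec {ι : Type*} [Fintype ι] (A : Matrix ι ι ℝ) :
    IsProbabilityMeasure (gaussVec A) :=
  Measure.isProbabilityMeasure_map (measurable_mulVec A).aemeasurable

theorem dotProduct_conj_diagonal_mulVec {ι : Type*} [Fintype ι] [DecidableEq ι]
    (A : Matrix ι ι ℝ) (w x : ι → ℝ) :
    x ⬝ᵥ (Aᵀ * diagonal w * A) *ᵥ x = ∑ y, w y * (A *ᵥ x) y ^ 2 := by
  rw [← Matrix.mulVec_mulVec, ← Matrix.mulVec_mulVec, Matrix.dotProduct_mulVec,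
    Matrix.vecMul_transpose]
  simp only [dotProduct, Matrix.mulVec_diagonal]
  exact Finset.sum_congr rfl fun y _ => by ring

theorem measurable_quadVarP (k n : ℕ) (Ls : Fin k → ℕ) (p : Fin k) :
    Measurable (quadVarP k n Ls p) := by
  unfold quadVarP
  refine Finset.measurable_sum _ fun i _ => ?_
  split_ifs <;> fun_prop

theorem memLp_quadVarP (k n : ℕ) (Ls : Fin k → ℕ)
    (A : Matrix (Fin k × Fin n) (Fin k × Fin n) ℝ) (p : Fin k) :
    MemLp (quadVarP k n Ls p) 2 (gaussVec A) := by
  unfold gaussVec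
  rw [memLp_map_measure_iff (measurable_quadVarP k n Ls p).aestronglyMeasurable
    (measurable_mulVec A).aemeasurable]
  convert memLp_quadForm (Aᵀ * diagonal (fun y : Fin k × Fin n =>
    if y.1 = p ∧ (y.2 : ℕ) + Ls p ≤ n then (1 : ℝ) else 0) * A) using 1
  funext x
  rw [dotProduct_conj_diagonal_mulVec, Fintype.sum_prod_type, Finset.sum_eq_single p]
  · simp [quadVarP]
  · intro q _ hq
    simp [hq]
  · simp

theorem charFun_gaussVec {ι : Type*} [Fintype ι] (B : Matrix ι ι ℝ) (t : EuclideanSpace ℝ ι) :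
    charFun ((gaussVec B).map (WithLp.toLp 2)) t
      = Complex.exp (-((t.ofLp ⬝ᵥ (B * Bᵀ) *ᵥ t.ofLp) / 2 : ℝ)) := by
  have h := charFun_stdGaussian (E := EuclideanSpace ℝ ι) (WithLp.toLp 2 (Bᵀ *ᵥ t.ofLp))
  rw [← map_pi_eq_stdGaussian, charFun_apply, integral_map (by fun_prop) (by fun_prop)] at h
  rw [charFun_apply, integral_map (by fun_prop) (by fun_prop), gaussVec,
    integral_map (measurable_mulVec B).aemeasurable (by fun_prop)]
  have hn : ‖(WithLp.toLp 2 (Bᵀ *ᵥ t.ofLp) : EuclideanSpace ℝ ι)‖ ^ 2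
      = t.ofLp ⬝ᵥ (B * Bᵀ) *ᵥ t.ofLp := by
    rw [EuclideanSpace.real_norm_sq_eq, ← Matrix.mulVec_mulVec, Matrix.dotProduct_mulVec,
      ← Matrix.mulVec_transpose]
    simp [dotProduct, pow_two]
  rw [← hn]
  have hrhs : Complex.exp (-((‖(WithLp.toLp 2 (Bᵀ *ᵥ t.ofLp) : EuclideanSpace ℝ ι)‖ ^ 2 / 2 : ℝ)))
      = Complex.exp (-‖(WithLp.toLp 2 (Bᵀ *ᵥ t.ofLp) : EuclideanSpace ℝ ι)‖ ^ 2 / 2) := by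
    congr 1
    push_cast
    ring
  rw [hrhs, ← h]
  congr 1
  funext x
  congr 3
  simp only [EuclideanSpace.inner_eq_star_dotProduct, star_trivial]
  rw [Matrix.dotProduct_mulVec, ← Matrix.mulVec_transpose]

/-- Joint central limit theorem for the quadratic variations of Gaussian vectors whose covariance
matrices have row sums negligible with respect to the normalization. -/
theorem tendsto_integral_quadVarP_of_row_sum (k : ℕ) (Ls : Fin k → ℕ)
    (A : (n : ℕ) → Matrix (Fin k × Fin n) (Fin k × Fin n) ℝ) (N ρ : ℕ → ℝ)
    (hN : ∀ᶠ n in atTop, 0 < N n) (hρ : Tendsto ρ atTop (nhds 0))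
    (hrow : ∀ᶠ n in atTop, ∀ x, ∑ y, |(A n * (A n)ᵀ) x y| ≤ ρ n * N n)
    (Λ B : Matrix (Fin k) (Fin k) ℝ) (hB : B * Bᵀ = Λ)
    (hΛ : ∀ p q, Tendsto (fun n => covVP k n Ls (A n) p q / N n ^ 2) atTop (nhds (Λ p q)))
    (g : BoundedContinuousFunction (Fin k → ℝ) ℝ) :
    Tendsto (fun n : ℕ =>
        ∫ z, g (fun p => (quadVarP k n Ls p z - expVP k n Ls (A n) p) / N n) ∂(gaussVec (A n)))
      atTop (nhds (∫ x, g x ∂(gaussVec B))) := by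
  set Z : (n : ℕ) → (Fin k × Fin n → ℝ) → EuclideanSpace ℝ (Fin k) := fun n z =>
    WithLp.toLp 2 (fun p => (quadVarP k n Ls p z - expVP k n Ls (A n) p) / N n) with hZ
  have hZm : ∀ n, Measurable (Z n) := by
    intro n
    refine (WithLp.measurable_toLp 2 _).comp (measurable_pi_lambda _ fun p => ?_)
    exact ((measurable_quadVarP k n Ls p).sub_const _).div_const _
  set μ : ℕ → ProbabilityMeasure (EuclideanSpace ℝ (Fin k)) := fun n =>
    ⟨(gaussVec (A n)).map (Z n), Measure.isProbabilityMeasure_map (hZm n).aemeasurable⟩ with hμ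
  set μ₀ : ProbabilityMeasure (EuclideanSpace ℝ (Fin k)) :=
    ⟨(gaussVec B).map (WithLp.toLp 2), Measure.isProbabilityMeasure_map (by fun_prop)⟩ with hμ₀
  suffices h : Tendsto μ atTop (nhds μ₀) by
    rw [ProbabilityMeasure.tendsto_iff_forall_integral_tendsto] at h
    have h' := h (g.compContinuous ⟨WithLp.ofLp, by fun_prop⟩)
    simp only [hμ, hμ₀, ProbabilityMeasure.coe_mk] at h'
    have hgm : Measurable g := g.continuous.measurable
    rw [integral_map (by fun_prop) (by fun_prop)] at h'
    refine h'.congr fun n => ?_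
    rw [integral_map (hZm n).aemeasurable (by fun_prop)]
    rfl
  rw [ProbabilityMeasure.tendsto_iff_tendsto_charFun]
  intro t
  simp only [hμ, hμ₀, ProbabilityMeasure.coe_mk]
  rw [charFun_gaussVec, hB]
  set w : (n : ℕ) → (Fin k × Fin n) → ℝ := fun n y =>
    if (y.2 : ℕ) + Ls y.1 ≤ n then t y.1 / N n else 0 with hw
  set S : (n : ℕ) → Matrix (Fin k × Fin n) (Fin k × Fin n) ℝ := fun n =>
    (A n)ᵀ * diagonal (w n) * A n with hSdef
  have hS : ∀ n, (S n).IsHermitian := by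
    intro n
    rw [Matrix.IsHermitian, hSdef]
    simp [Matrix.mul_assoc, Matrix.conjTranspose_eq_transpose_of_trivial]
  have hquad : ∀ n x, x ⬝ᵥ S n *ᵥ x = ∑ p, t p / N n * quadVarP k n Ls p (A n *ᵥ x) := by
    intro n x
    rw [hSdef, dotProduct_conj_diagonal_mulVec, Fintype.sum_prod_type]
    refine Finset.sum_congr rfl fun p _ => ?_
    rw [quadVarP, Finset.mul_sum]
    refine Finset.sum_congr rfl fun i _ => ?_
    simp [hw]
  have hint : ∀ n p, Integrable (quadVarP k n Ls p) (gaussVec (A n)) := fun n p =>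
    (memLp_quadVarP k n Ls (A n) p).integrable (by norm_num)
  have hmean : ∀ n, ∫ y, y ⬝ᵥ S n *ᵥ y ∂(Measure.pi fun _ => gaussianReal 0 1)
      = ∑ p, t p / N n * expVP k n Ls (A n) p := by
    intro n
    simp_rw [hquad]
    have h := integral_map (μ := Measure.pi fun _ : Fin k × Fin n => gaussianReal 0 1)
      (measurable_mulVec (A n)).aemeasurable
      (f := fun z => ∑ p, t p / N n * quadVarP k n Ls p z)
      (Measurable.aestronglyMeasurable (Finset.measurable_sum _ fun p _ =>
        (measurable_quadVarP k n Ls p).const_mul _))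
    rw [← h]
    change ∫ z, _ ∂(gaussVec (A n)) = _
    rw [integral_finsetSum _ fun p _ => (hint n p).const_mul _]
    exact Finset.sum_congr rfl fun p _ => integral_const_mul _ _
  have hcent : ∀ n x, x ⬝ᵥ S n *ᵥ x - ∫ y, y ⬝ᵥ S n *ᵥ y ∂(Measure.pi fun _ => gaussianReal 0 1)
      = ∑ p, t p / N n * (quadVarP k n Ls p (A n *ᵥ x) - expVP k n Ls (A n) p) := by
    intro n x
    rw [hmean, hquad, ← Finset.sum_sub_distrib]
    exact Finset.sum_congr rfl fun p _ => by ring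
  set T := ∑ p, |t p| with hT
  have hT0 : 0 ≤ T := Finset.sum_nonneg fun p _ => abs_nonneg _
  have hρ' : Tendsto (fun n => T * ρ n) atTop (nhds 0) := by simpa using hρ.const_mul T
  have key := tendsto_integral_exp_quadForm hS hρ' (τ := t.ofLp ⬝ᵥ Λ *ᵥ t.ofLp) ?_ ?_
  · refine key.congr fun n => ?_
    rw [charFun_apply, integral_map (hZm n).aemeasurable (by fun_prop), gaussVec,
      integral_map (measurable_mulVec (A n)).aemeasurable (Measurable.aestronglyMeasurable (by
        have := hZm n
        fun_prop))]
    congr 1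
    funext x
    rw [hcent]
    congr 3
    simp only [hZ, EuclideanSpace.inner_eq_star_dotProduct, star_trivial, dotProduct]
    exact Finset.sum_congr rfl fun p _ => by ring
  · filter_upwards [hN, hrow] with n hn hr l
    refine abs_eigenvalues_le_of_row_sum (A n) (w n) (hS n) ?_ (fun x => ?_) l
    · by_cases hk : Nonempty (Fin k × Fin n)
      · obtain ⟨x⟩ := hk
        have h1 := (Finset.sum_nonneg fun y _ => abs_nonneg _).trans (hr x)
        exact mul_nonneg hT0 (nonneg_of_mul_nonneg_left h1 hn)
      · exact absurd ⟨l⟩ hk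
    · calc ∑ y, |(A n * (A n)ᵀ) x y| * |w n y|
          ≤ ∑ y, |(A n * (A n)ᵀ) x y| * (T / N n) := by
            refine Finset.sum_le_sum fun y _ => mul_le_mul_of_nonneg_left ?_ (abs_nonneg _)
            simp only [hw]
            split_ifs
            · rw [abs_div, abs_of_pos hn]
              gcongr
              exact Finset.single_le_sum (f := fun p => |t p|) (fun p _ => abs_nonneg _)
                (Finset.mem_univ _)
            · rw [abs_zero]
              positivity
        _ = (∑ y, |(A n * (A n)ᵀ) x y|) * (T / N n) := by rw [Finset.sum_mul]
        _ ≤ ρ n * N n * (T / N n) := mul_le_mul_of_nonneg_right (hr x) (by positivity)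
        _ = T * ρ n := by field_simp
  · have hvar : ∀ n, ∫ x, (x ⬝ᵥ S n *ᵥ x
        - ∫ y, y ⬝ᵥ S n *ᵥ y ∂(Measure.pi fun _ => gaussianReal 0 1)) ^ 2
        ∂(Measure.pi fun _ => gaussianReal 0 1)
        = ∑ p, ∑ q, t p * t q * (covVP k n Ls (A n) p q / N n ^ 2) := by
      intro n
      simp_rw [hcent]
      have hmV : ∀ p, Measurable fun z : Fin k × Fin n → ℝ =>
          t p / N n * (quadVarP k n Ls p z - expVP k n Ls (A n) p) := fun p =>
        ((measurable_quadVarP k n Ls p).sub_const _).const_mul _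
      have h := integral_map (μ := Measure.pi fun _ : Fin k × Fin n => gaussianReal 0 1)
        (measurable_mulVec (A n)).aemeasurable
        (f := fun z => (∑ p, t p / N n * (quadVarP k n Ls p z - expVP k n Ls (A n) p)) ^ 2)
        (((Finset.measurable_sum _ fun p _ => hmV p).pow_const 2).aestronglyMeasurable)
      rw [← h]
      change ∫ z, _ ∂(gaussVec (A n)) = _
      have hL : ∀ p, MemLp (fun z => quadVarP k n Ls p z - expVP k n Ls (A n) p) 2
          (gaussVec (A n)) := fun p => (memLp_quadVarP k n Ls (A n) p).sub (memLp_const _)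
      have hpq : ∀ p q, Integrable (fun z => t p * t q / N n ^ 2 *
          ((quadVarP k n Ls p z - expVP k n Ls (A n) p)
            * (quadVarP k n Ls q z - expVP k n Ls (A n) q))) (gaussVec (A n)) := fun p q =>
        ((hL p).integrable_mul (hL q)).const_mul _
      have hexpand : ∀ z : Fin k × Fin n → ℝ,
          (∑ p, t p / N n * (quadVarP k n Ls p z - expVP k n Ls (A n) p)) ^ 2
          = ∑ p, ∑ q, t p * t q / N n ^ 2 * ((quadVarP k n Ls p z - expVP k n Ls (A n) p)
            * (quadVarP k n Ls q z - expVP k n Ls (A n) q)) := by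
        intro z
        rw [pow_two, Finset.sum_mul_sum]
        exact Finset.sum_congr rfl fun p _ => Finset.sum_congr rfl fun q _ => by ring
      simp_rw [hexpand]
      rw [integral_finsetSum _ fun p _ => integrable_finsetSum _ fun q _ => hpq p q]
      refine Finset.sum_congr rfl fun p _ => ?_
      rw [integral_finsetSum _ fun q _ => hpq p q]
      refine Finset.sum_congr rfl fun q _ => ?_
      rw [integral_const_mul, covVP]
      ring
    simp_rw [hvar]
    have hlim : t.ofLp ⬝ᵥ Λ *ᵥ t.ofLp = ∑ p, ∑ q, t p * t q * Λ p q := by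
      simp only [dotProduct, mulVec, Finset.mul_sum]
      exact Finset.sum_congr rfl fun p _ => Finset.sum_congr rfl fun q _ => by ring
    rw [hlim]
    exact tendsto_finsetSum _ fun p _ => tendsto_finsetSum _ fun q _ => (hΛ p q).const_mul _

theorem sum_mul_add_pow_eq_zero (F : Finset ℤ) (b : ℤ → ℝ) (N : ℕ)
    (hmom : ∀ e < N, ∑ m ∈ F, b m * (m : ℝ) ^ e = 0) (c : ℝ) {e : ℕ} (he : e < N) :
    ∑ m ∈ F, b m * ((m : ℝ) + c) ^ e = 0 := by
  simp_rw [add_pow, Finset.mul_sum]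
  rw [Finset.sum_comm]
  refine Finset.sum_eq_zero fun l hl => ?_
  have hl' : l < N := (Nat.lt_succ_iff.1 (Finset.mem_range.1 hl)).trans_lt he
  have : ∀ m ∈ F, b m * ((m : ℝ) ^ l * c ^ (e - l) * (e.choose l : ℝ))
      = (b m * (m : ℝ) ^ l) * (c ^ (e - l) * (e.choose l : ℝ)) := fun m _ => by ring
  rw [Finset.sum_congr rfl this, ← Finset.sum_mul, hmom l hl', zero_mul]

/-- A finite difference operator annihilating polynomials of degree less than `n` is controlled
by the `n`-th derivative. -/
theorem abs_sum_mul_le_of_iteratedDeriv_le (R : ℕ) (b : ℤ → ℝ) {N n : ℕ} (hn : n ≤ N)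
    (hmom : ∀ e < N, ∑ m ∈ Finset.Icc (-(R : ℤ)) R, b m * (m : ℝ) ^ e = 0) (f : ℝ → ℝ) {δ : ℝ}
    (hδ : 0 < δ) (hR : 1 ≤ R) (x : ℝ)
    (hf : ∀ y ∈ Set.Icc (x - R * δ) (x + R * δ), ContDiffAt ℝ n f y) {M : ℝ}
    (hM : ∀ y ∈ Set.Icc (x - R * δ) (x + R * δ), |iteratedDeriv n f y| ≤ M) :
    |∑ m ∈ Finset.Icc (-(R : ℤ)) R, b m * f (x + m * δ)|
      ≤ (∑ m ∈ Finset.Icc (-(R : ℤ)) R, |b m|) * (M * (2 * R * δ) ^ n) := by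
  have hR' : (1 : ℝ) ≤ R := by exact_mod_cast hR
  have hRδ : 0 < R * δ := by positivity
  have hmem : ∀ m ∈ Finset.Icc (-(R : ℤ)) R, x + m * δ ∈ Set.Icc (x - R * δ) (x + R * δ) := by
    intro m hm
    rw [Finset.mem_Icc] at hm
    have h1 : (-(R : ℝ)) ≤ m := by exact_mod_cast hm.1
    have h2 : (m : ℝ) ≤ R := by exact_mod_cast hm.2
    constructor <;> nlinarith
  have hM0 : 0 ≤ M := (abs_nonneg _).trans (hM x ⟨by linarith, by linarith⟩)
  have hpoint : ∃ P : ℝ → ℝ, (∑ m ∈ Finset.Icc (-(R : ℤ)) R, b m * P (x + m * δ) = 0) ∧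
      ∀ y ∈ Set.Icc (x - R * δ) (x + R * δ), |f y - P y| ≤ M * (2 * R * δ) ^ n := by
    rcases n with _ | n
    · exact ⟨fun _ => 0, by simp, fun y hy => by simpa using hM y hy⟩
    · have hu := uniqueDiffOn_Icc (show x - R * δ < x + R * δ by linarith)
      refine ⟨taylorWithinEval f n (Set.Icc (x - R * δ) (x + R * δ)) (x - R * δ), ?_, ?_⟩
      · simp_rw [taylor_within_apply, Finset.mul_sum]
        rw [Finset.sum_comm]
        refine Finset.sum_eq_zero fun l hl => ?_
        have hl' : l < N := (Finset.mem_range.1 hl).trans_le hn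
        have h0 := sum_mul_add_pow_eq_zero _ b N hmom (R : ℝ) hl'
        set c := iteratedDerivWithin l f (Set.Icc (x - R * δ) (x + R * δ)) (x - R * δ)
        have : ∀ m ∈ Finset.Icc (-(R : ℤ)) R,
            b m * (((l.factorial : ℝ)⁻¹ * (x + m * δ - (x - R * δ)) ^ l) • c)
            = (b m * ((m : ℝ) + R) ^ l) * ((l.factorial : ℝ)⁻¹ * δ ^ l * c) := by
          intro m _
          have : x + m * δ - (x - R * δ) = (m + R) * δ := by ring
          rw [this, mul_pow, smul_eq_mul]
          ring
        rw [Finset.sum_congr rfl this, ← Finset.sum_mul, h0, zero_mul]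
      · intro y hy
        have hb := taylor_mean_remainder_bound (f := f) (n := n) (C := M)
          (show x - R * δ ≤ x + R * δ by linarith)
          (fun z hz => (hf z hz).contDiffWithinAt) hy (fun z hz => by
            rw [iteratedDerivWithin_eq_iteratedDeriv hu (hf z hz) hz]
            exact hM z hz)
        rw [Real.norm_eq_abs] at hb
        refine hb.trans ((div_le_self ?_ ?_).trans ?_)
        · exact mul_nonneg hM0 (pow_nonneg (by linarith [hy.1]) _)
        · exact_mod_cast n.factorial_pos
        · refine mul_le_mul_of_nonneg_left (pow_le_pow_left₀ (by linarith [hy.1]) ?_ _) hM0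
          linarith [hy.2]
  obtain ⟨P, hP0, hP⟩ := hpoint
  have hsub : ∑ m ∈ Finset.Icc (-(R : ℤ)) R, b m * f (x + m * δ)
      = ∑ m ∈ Finset.Icc (-(R : ℤ)) R, b m * (f (x + m * δ) - P (x + m * δ)) := by
    simp_rw [mul_sub]
    rw [Finset.sum_sub_distrib, hP0, sub_zero]
  rw [hsub, Finset.sum_mul]
  refine (Finset.abs_sum_le_sum_abs _ _).trans (Finset.sum_le_sum fun m hm => ?_)
  rw [abs_mul]
  exact mul_le_mul_of_nonneg_left (hP _ (hmem m hm)) (abs_nonneg _)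

theorem exists_abs_le_mul_rpow {r : ℝ → ℝ} {s K : ℝ} (hr : Continuous r) (hs : 0 < s)
    (hro : r =o[nhds (0 : ℝ)] fun h => |h| ^ s) (hK : ∀ h : ℝ, 1 < |h| → |r h| ≤ K * |h| ^ s) :
    ∃ K' : ℝ, 0 < K' ∧ ∀ h, |r h| ≤ K' * |h| ^ s := by
  have h1 := (Asymptotics.isLittleO_iff.1 hro) one_pos
  obtain ⟨η, hη, hη'⟩ := Metric.eventually_nhds_iff.1 h1
  obtain ⟨M, hM⟩ := (isCompact_Icc (a := (-1 : ℝ)) (b := 1)).exists_bound_of_continuousOn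
    hr.continuousOn
  have hηs : 0 < η ^ s := Real.rpow_pos_of_pos hη s
  refine ⟨max 1 (max K (M / η ^ s)), by positivity, fun h => ?_⟩
  have hp : 0 ≤ |h| ^ s := by positivity
  rcases lt_or_ge (|h|) η with hh | hh
  · have := hη' (y := h) (by simpa using hh)
    simp only [Real.norm_eq_abs, one_mul, abs_of_nonneg hp] at this
    exact this.trans (le_mul_of_one_le_left hp (le_max_left _ _))
  · rcases lt_or_ge 1 (|h|) with h2 | h2
    · exact (hK h h2).trans (mul_le_mul_of_nonneg_right
        ((le_max_left _ _).trans (le_max_right _ _)) hp)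
    · have hMh : |r h| ≤ M := hM h (abs_le.1 h2)
      have hM0 : 0 ≤ M := (abs_nonneg _).trans hMh
      calc |r h| ≤ M / η ^ s * η ^ s := by rw [div_mul_cancel₀ _ hηs.ne']; exact hMh
        _ ≤ M / η ^ s * |h| ^ s := mul_le_mul_of_nonneg_left
            (Real.rpow_le_rpow hη.le hh hs.le) (by positivity)
        _ ≤ _ := mul_le_mul_of_nonneg_right ((le_max_right _ _).trans (le_max_right _ _)) hp

theorem iteratedDeriv_add_nat (m n : ℕ) (f : ℝ → ℝ) :
    iteratedDeriv (m + n) f = iteratedDeriv n (iteratedDeriv m f) := by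
  rw [iteratedDeriv_eq_iterate, iteratedDeriv_eq_iterate, iteratedDeriv_eq_iterate, add_comm,
    Function.iterate_add_apply]

theorem contDiffAt_of_even {V : ℝ → ℝ} (hEven : ∀ h : ℝ, V (-h) = V h)
    (hSmooth : ContDiffOn ℝ (⊤ : ℕ∞) V (Set.Ioi 0)) (n : ℕ) {y : ℝ} (hy : y ≠ 0) :
    ContDiffAt ℝ n V y := by
  have hpos : ∀ z : ℝ, 0 < z → ContDiffAt ℝ n V z := fun z hz =>
    (hSmooth.contDiffAt (Ioi_mem_nhds hz)).of_le (by exact_mod_cast le_top)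
  rcases hy.lt_or_gt with h | h
  · have h1 : V = fun z => V (-z) := funext fun z => (hEven z).symm
    rw [h1]
    exact (hpos (-y) (neg_pos.2 h)).comp y contDiff_neg.contDiffAt
  · exact hpos y h

/-- Bound on a derivative of order `2 * D + d` of the variogram away from the origin. -/
theorem abs_iteratedDeriv_le_of_expansion {V r : ℝ → ℝ} {D d : ℕ} {C s β K : ℝ}
    (hEven : ∀ h : ℝ, V (-h) = V h)
    (hExp : ∀ h : ℝ, iteratedDeriv (2 * D) V h
      = iteratedDeriv (2 * D) V 0 + C * (-1 : ℝ) ^ D * |h| ^ s + r h)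
    (hd : 1 ≤ d) (hrd : ∀ y : ℝ, y ≠ 0 → ContDiffAt ℝ d r y)
    (hK : ∀ h : ℝ, h ≠ 0 → |iteratedDeriv d r h| ≤ K * |h| ^ β) {y : ℝ} (hy : y ≠ 0) :
    |iteratedDeriv (2 * D + d) V y|
      ≤ |C| * |(descPochhammer ℝ d).eval s| * |y| ^ (s - d) + K * |y| ^ β := by
  have hpos : ∀ z : ℝ, 0 < z → |iteratedDeriv (2 * D + d) V z|
      ≤ |C| * |(descPochhammer ℝ d).eval s| * |z| ^ (s - d) + K * |z| ^ β := by
    intro z hz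
    have hev : iteratedDeriv (2 * D) V =ᶠ[nhds z]
        fun h => iteratedDeriv (2 * D) V 0 + (C * (-1 : ℝ) ^ D * h ^ s + r h) := by
      filter_upwards [Ioi_mem_nhds hz] with h hh
      rw [hExp h, abs_of_pos hh]
      ring
    have hsm : ContDiffAt ℝ d (fun h : ℝ => C * (-1 : ℝ) ^ D * h ^ s) z :=
      contDiffAt_const.mul (Real.contDiffAt_rpow_const_of_ne hz.ne')
    rw [iteratedDeriv_add_nat, hev.iteratedDeriv_eq, iteratedDeriv_const_add (by omega),
      iteratedDeriv_fun_add hsm (hrd z hz.ne'), iteratedDeriv_const_mul_field,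
      iteratedDeriv_eq_iterate (f := fun h : ℝ => h ^ s), Real.iter_deriv_rpow_const]
    refine (abs_add_le _ _).trans (add_le_add (le_of_eq ?_) (hK z hz.ne'))
    rw [abs_mul, abs_mul, abs_mul, abs_pow, abs_neg, abs_one, one_pow, mul_one, abs_of_pos hz,
      abs_of_pos (Real.rpow_pos_of_pos hz _), mul_assoc]
  rcases hy.lt_or_gt with h | h
  · have h1 : V = fun z => V (-z) := funext fun z => (hEven z).symm
    rw [h1, iteratedDeriv_comp_neg, smul_eq_mul, abs_mul, abs_pow, abs_neg, abs_one, one_pow,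
      one_mul, ← abs_neg y]
    exact hpos (-y) (neg_pos.2 h)
  · exact hpos y h

theorem rpow_neg_le_of_mul_le {a γ e δ u y : ℝ} (hγ : γ ≤ a) (ha : 0 ≤ a) (hae : a ≤ e)
    (hδ : 0 < δ) (hδ1 : δ ≤ 1) (hu : 1 ≤ u) (hy : u * δ / 4 ≤ y) :
    y ^ (-a) ≤ 4 ^ a * (u ^ (-γ) * δ ^ (-e)) := by
  have hu0 : 0 < u := by linarith
  calc y ^ (-a) ≤ (u * δ / 4) ^ (-a) :=
        Real.rpow_le_rpow_of_nonpos (by positivity) hy (by linarith)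
    _ = 4 ^ a * (u ^ (-a) * δ ^ (-a)) := by
        rw [Real.div_rpow (by positivity) (by norm_num), Real.mul_rpow hu0.le hδ.le,
          Real.rpow_neg (by norm_num : (0 : ℝ) ≤ 4), div_inv_eq_mul, mul_comm]
    _ ≤ 4 ^ a * (u ^ (-γ) * δ ^ (-e)) := by
        have h1 : u ^ (-a) ≤ u ^ (-γ) := Real.rpow_le_rpow_of_exponent_le hu (by linarith)
        have h2 : δ ^ (-a) ≤ δ ^ (-e) := Real.rpow_le_rpow_of_exponent_ge hδ hδ1 (by linarith)
        gcongr

/-- Decay of the covariance of generalized increments at distant points. -/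
theorem abs_sum_mul_variogram_le_of_far {V r : ℝ → ℝ} {D d N R : ℕ} {C s β K γ : ℝ} {b : ℤ → ℝ}
    (hEven : ∀ h : ℝ, V (-h) = V h) (hSmooth : ContDiffOn ℝ (⊤ : ℕ∞) V (Set.Ioi 0))
    (hExp : ∀ h : ℝ, iteratedDeriv (2 * D) V h
      = iteratedDeriv (2 * D) V 0 + C * (-1 : ℝ) ^ D * |h| ^ s + r h)
    (hd : 1 ≤ d) (hrd : ∀ y : ℝ, y ≠ 0 → ContDiffAt ℝ d r y)
    (hK : ∀ h : ℝ, h ≠ 0 → |iteratedDeriv d r h| ≤ K * |h| ^ β) (hK0 : 0 < K)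
    (hγ0 : 0 ≤ γ) (hγ1 : γ ≤ d - s) (hγ2 : γ ≤ -β) (hβ : s - d ≤ β)
    (hN : 2 * D + d ≤ N) (hR : 1 ≤ R)
    (hmom : ∀ e < N, ∑ m ∈ Finset.Icc (-(R : ℤ)) R, b m * (m : ℝ) ^ e = 0) :
    ∃ K₁ : ℝ, 0 ≤ K₁ ∧ ∀ δ : ℝ, 0 < δ → δ ≤ 1 → ∀ j : ℤ, 2 * (R : ℝ) ≤ |(j : ℝ)| →
      |∑ m ∈ Finset.Icc (-(R : ℤ)) R, b m * V ((j + m) * δ)|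
        ≤ K₁ * (δ ^ (2 * (D : ℝ) + s) * (1 + |(j : ℝ)|) ^ (-γ)) := by
  have hR' : (1 : ℝ) ≤ R := by exact_mod_cast hR
  set C₁ := |C| * |(descPochhammer ℝ d).eval s| with hC₁
  have hC₁0 : 0 ≤ C₁ := by positivity
  refine ⟨(∑ m ∈ Finset.Icc (-(R : ℤ)) R, |b m|) * ((C₁ * 4 ^ ((d : ℝ) - s) + K * 4 ^ (-β))
    * (2 * R) ^ (2 * D + d)), by positivity, fun δ hδ hδ1 j hj => ?_⟩
  set u := 1 + |(j : ℝ)| with hu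
  have hu1 : 1 ≤ u := by rw [hu]; linarith [abs_nonneg (j : ℝ)]
  have hy : ∀ y ∈ Set.Icc ((j : ℝ) * δ - R * δ) (j * δ + R * δ), u * δ / 4 ≤ |y| := by
    intro y hy
    have h1 : |y - j * δ| ≤ R * δ := abs_le.2 ⟨by linarith [hy.1], by linarith [hy.2]⟩
    have h2 : |(j : ℝ)| * δ ≤ |y| + R * δ := by
      have h3 := abs_sub_abs_le_abs_sub ((j : ℝ) * δ) y
      rw [abs_mul, abs_of_pos hδ, abs_sub_comm] at h3
      linarith
    nlinarith
  have hypos : ∀ y ∈ Set.Icc ((j : ℝ) * δ - R * δ) (j * δ + R * δ), y ≠ 0 := by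
    intro y hyy h0
    have := hy y hyy
    rw [h0, abs_zero] at this
    nlinarith [mul_pos (lt_of_lt_of_le one_pos hu1) hδ]
  have hmain := abs_sum_mul_le_of_iteratedDeriv_le R b hN hmom V hδ hR (j * δ)
    (fun y hyy => contDiffAt_of_even hEven hSmooth _ (hypos y hyy))
    (M := (C₁ * 4 ^ ((d : ℝ) - s) + K * 4 ^ (-β)) * (u ^ (-γ) * δ ^ (-((d : ℝ) - s))))
    (fun y hyy => by
      refine (abs_iteratedDeriv_le_of_expansion hEven hExp hd hrd hK (hypos y hyy)).trans ?_
      have h1 := rpow_neg_le_of_mul_le hγ1 (hγ0.trans hγ1) le_rfl hδ hδ1 hu1 (hy y hyy)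
      have h2 := rpow_neg_le_of_mul_le (e := (d : ℝ) - s) hγ2 (hγ0.trans hγ2) (by linarith) hδ hδ1
        hu1 (hy y hyy)
      rw [neg_sub] at h1
      rw [neg_neg] at h2
      rw [add_mul, mul_assoc C₁, mul_assoc K]
      simp only [neg_sub] at h1 h2 ⊢
      gcongr)
  have hδd : δ ^ (-((d : ℝ) - s)) * δ ^ (2 * D + d) = δ ^ (2 * (D : ℝ) + s) := by
    rw [← Real.rpow_natCast, ← Real.rpow_add hδ]
    congr 1
    push_cast
    ring
  simp_rw [add_mul (j : ℝ)]
  refine hmain.trans (le_of_eq ?_)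
  rw [← hδd, mul_pow]
  ring

/-- Bound on the covariance of generalized increments at nearby points. -/
theorem abs_sum_mul_variogram_le_of_near {V r : ℝ → ℝ} {D N R : ℕ} {C s K γ : ℝ} {b : ℤ → ℝ}
    (hs : 0 < s) (hV2D : ContDiff ℝ (2 * D : ℕ) V)
    (hExp : ∀ h : ℝ, iteratedDeriv (2 * D) V h
      = iteratedDeriv (2 * D) V 0 + C * (-1 : ℝ) ^ D * |h| ^ s + r h)
    (hro : r =o[nhds (0 : ℝ)] fun h => |h| ^ s) (hK : ∀ h : ℝ, 1 < |h| → |r h| ≤ K * |h| ^ s)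
    (hγ0 : 0 ≤ γ) (hN : 2 * D < N) (hR : 1 ≤ R)
    (hmom : ∀ e < N, ∑ m ∈ Finset.Icc (-(R : ℤ)) R, b m * (m : ℝ) ^ e = 0) :
    ∃ K₂ : ℝ, 0 ≤ K₂ ∧ ∀ δ : ℝ, 0 < δ → ∀ j : ℤ, |(j : ℝ)| ≤ 2 * (R : ℝ) →
      |∑ m ∈ Finset.Icc (-(R : ℤ)) R, b m * V ((j + m) * δ)|
        ≤ K₂ * (δ ^ (2 * (D : ℝ) + s) * (1 + |(j : ℝ)|) ^ (-γ)) := by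
  have hR' : (1 : ℝ) ≤ R := by exact_mod_cast hR
  have hrc : Continuous r := by
    have h1 : r = fun h => iteratedDeriv (2 * D) V h
        - (iteratedDeriv (2 * D) V 0 + C * (-1 : ℝ) ^ D * |h| ^ s) :=
      funext fun h => by rw [hExp h]; ring
    rw [h1]
    refine (hV2D.continuous_iteratedDeriv _ le_rfl).sub (continuous_const.add
      (continuous_const.mul (continuous_abs.rpow_const fun _ => Or.inr hs.le)))
  obtain ⟨K', hK'0, hK'⟩ := exists_abs_le_mul_rpow hrc hs hro hK
  refine ⟨(∑ m ∈ Finset.Icc (-(R : ℤ)) R, |b m|) * ((|C| + K') * (3 * R) ^ s * (2 * R) ^ (2 * D))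
    * (1 + 2 * R) ^ γ, by positivity, fun δ hδ j hj => ?_⟩
  set c := iteratedDeriv (2 * D) V 0 / ((2 * D).factorial : ℝ) with hc
  have hcd : ContDiff ℝ (2 * D : ℕ) (fun y : ℝ => c * y ^ (2 * D)) := by fun_prop
  have hder : ∀ y, iteratedDeriv (2 * D) (fun y => V y - c * y ^ (2 * D)) y
      = C * (-1 : ℝ) ^ D * |y| ^ s + r y := by
    intro y
    rw [iteratedDeriv_fun_sub hV2D.contDiffAt hcd.contDiffAt, hExp y, iteratedDeriv_const_mul_field,
      iteratedDeriv_pow, Nat.descFactorial_self, Nat.sub_self, pow_zero, mul_one, hc,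
      div_mul_cancel₀ _ (by positivity)]
    ring
  have hmain := abs_sum_mul_le_of_iteratedDeriv_le R b hN.le hmom
    (fun y => V y - c * y ^ (2 * D)) hδ hR (j * δ)
    (fun y _ => (hV2D.sub hcd).contDiffAt) (M := (|C| + K') * (3 * R * δ) ^ s)
    (fun y hy => by
      have hyb : |y| ≤ 3 * R * δ := by
        have h1 := abs_le.1 hj
        refine abs_le.2 ⟨?_, ?_⟩
        · nlinarith [hy.1, mul_le_mul_of_nonneg_right h1.1 hδ.le]
        · nlinarith [hy.2, mul_le_mul_of_nonneg_right h1.2 hδ.le]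
      rw [hder]
      refine (abs_add_le _ _).trans ?_
      rw [abs_mul, abs_mul, abs_pow, abs_neg, abs_one, one_pow, mul_one,
        abs_of_nonneg (Real.rpow_nonneg (abs_nonneg y) s)]
      calc |C| * |y| ^ s + |r y| ≤ |C| * |y| ^ s + K' * |y| ^ s := by linarith [hK' y]
        _ = (|C| + K') * |y| ^ s := by ring
        _ ≤ _ := by gcongr)
  have hpoly : ∑ m ∈ Finset.Icc (-(R : ℤ)) R, b m * (c * (j * δ + m * δ) ^ (2 * D)) = 0 := by
    have h0 := sum_mul_add_pow_eq_zero _ b N hmom (j : ℝ) hN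
    have : ∀ m ∈ Finset.Icc (-(R : ℤ)) R, b m * (c * ((j : ℝ) * δ + m * δ) ^ (2 * D))
        = (b m * ((m : ℝ) + j) ^ (2 * D)) * (c * δ ^ (2 * D)) := by
      intro m _
      rw [show (j : ℝ) * δ + m * δ = (m + j) * δ by ring, mul_pow]
      ring
    rw [Finset.sum_congr rfl this, ← Finset.sum_mul, h0, zero_mul]
  simp_rw [mul_sub] at hmain
  rw [Finset.sum_sub_distrib, hpoly, sub_zero] at hmain
  have hδd : δ ^ s * δ ^ (2 * D) = δ ^ (2 * (D : ℝ) + s) := by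
    rw [← Real.rpow_natCast, ← Real.rpow_add hδ]
    congr 1
    push_cast
    ring
  have hγb : 1 ≤ (1 + 2 * (R : ℝ)) ^ γ * (1 + |(j : ℝ)|) ^ (-γ) := by
    rw [Real.rpow_neg (by positivity), ← div_eq_mul_inv, one_le_div (by positivity)]
    gcongr
  simp_rw [add_mul (j : ℝ)]
  refine hmain.trans ?_
  rw [Real.mul_rpow (by positivity) hδ.le, mul_pow, ← hδd]
  calc _ = (∑ m ∈ Finset.Icc (-(R : ℤ)) R, |b m|) * ((|C| + K') * (3 * R) ^ s * (2 * R) ^ (2 * D))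
        * (δ ^ s * δ ^ (2 * D)) * 1 := by ring
    _ ≤ (∑ m ∈ Finset.Icc (-(R : ℤ)) R, |b m|) * ((|C| + K') * (3 * R) ^ s * (2 * R) ^ (2 * D))
        * (δ ^ s * δ ^ (2 * D)) * ((1 + 2 * (R : ℝ)) ^ γ * (1 + |(j : ℝ)|) ^ (-γ)) := by gcongr
    _ = _ := by ring

theorem sum_range_one_add_rpow_neg_le {γ : ℝ} (hγ0 : 0 ≤ γ) (hγ1 : γ < 1) (n : ℕ) :
    ∑ j ∈ Finset.range n, (1 + (j : ℝ)) ^ (-γ) ≤ (n : ℝ) ^ (1 - γ) / (1 - γ) := by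
  induction n with
  | zero => simp [Real.zero_rpow (by linarith : (1 : ℝ) - γ ≠ 0)]
  | succ n ih =>
    rw [Finset.sum_range_succ]
    have h1 : (0 : ℝ) < 1 - γ := by linarith
    have hn : (0 : ℝ) < 1 + n := by positivity
    have hb := rpow_one_add_le_one_add_mul_self (s := -1 / (1 + (n : ℝ)))
      (by rw [le_div_iff₀ hn]; linarith) h1.le (by linarith : (1 : ℝ) - γ ≤ 1)
    have he : 1 + -1 / (1 + (n : ℝ)) = n / (1 + n) := by field_simp; ring
    rw [he, Real.div_rpow (by positivity) hn.le, div_le_iff₀ (by positivity)] at hb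
    have hg : (1 + (n : ℝ)) ^ (1 - γ) = (1 + n) * (1 + (n : ℝ)) ^ (-γ) := by
      rw [sub_eq_add_neg, Real.rpow_add hn, Real.rpow_one]
    have hb' : (n : ℝ) ^ (1 - γ) ≤ (1 + (n : ℝ)) ^ (1 - γ) - (1 - γ) * (1 + (n : ℝ)) ^ (-γ) := by
      refine hb.trans (le_of_eq ?_)
      rw [hg]
      field_simp
      ring
    rw [le_div_iff₀ h1] at ih ⊢
    push_cast
    rw [add_comm (n : ℝ) 1]
    linarith

theorem sum_fin_one_add_abs_sub_rpow_neg_le {γ : ℝ} (hγ0 : 0 ≤ γ) (hγ1 : γ < 1) {n : ℕ}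
    (i : Fin n) :
    ∑ i' : Fin n, (1 + |(((i : ℤ) - (i' : ℤ) : ℤ) : ℝ)|) ^ (-γ)
      ≤ 2 * ((n : ℝ) ^ (1 - γ) / (1 - γ)) := by
  have h1 := sum_range_one_add_rpow_neg_le hγ0 hγ1 n
  have hnn : ∀ j : ℕ, 0 ≤ (1 + (j : ℝ)) ^ (-γ) := fun j => by positivity
  have key : ∀ i' : Fin n, (1 + |(((i : ℤ) - (i' : ℤ) : ℤ) : ℝ)|) ^ (-γ)
      ≤ (if (i' : ℕ) ≤ i then (1 + (((i : ℕ) - i' : ℕ) : ℝ)) ^ (-γ) else 0)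
        + (if (i : ℕ) ≤ i' then (1 + (((i' : ℕ) - i : ℕ) : ℝ)) ^ (-γ) else 0) := by
    intro i'
    rcases le_total (i' : ℕ) i with h | h
    · have : |(((i : ℤ) - (i' : ℤ) : ℤ) : ℝ)| = (((i : ℕ) - i' : ℕ) : ℝ) := by
        rw [Nat.cast_sub h, abs_of_nonneg] <;> push_cast
        · rfl
        · have : (i' : ℝ) ≤ (i : ℕ) := by exact_mod_cast h
          simpa using this
      rw [this, if_pos h]
      refine le_add_of_nonneg_right ?_
      split_ifs
      exacts [hnn _, le_rfl]
    · have : |(((i : ℤ) - (i' : ℤ) : ℤ) : ℝ)| = (((i' : ℕ) - i : ℕ) : ℝ) := by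
        rw [Nat.cast_sub h, abs_of_nonpos] <;> push_cast
        · ring
        · have : (i : ℝ) ≤ (i' : ℕ) := by exact_mod_cast h
          simpa using this
      rw [this, if_pos h]
      refine le_add_of_nonneg_left ?_
      split_ifs
      exacts [hnn _, le_rfl]
  refine (Finset.sum_le_sum fun i' _ => key i').trans ?_
  rw [Finset.sum_add_distrib, two_mul]
  refine add_le_add (le_trans ?_ h1) (le_trans ?_ h1)
  · rw [Fin.sum_univ_eq_sum_range
      (fun i' => if i' ≤ (i : ℕ) then (1 + (((i : ℕ) - i' : ℕ) : ℝ)) ^ (-γ) else 0),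
      ← Finset.sum_filter, ← Finset.sum_image (f := fun j : ℕ => (1 + (j : ℝ)) ^ (-γ))
        (g := fun i' => (i : ℕ) - i')]
    · refine Finset.sum_le_sum_of_subset_of_nonneg ?_ fun j _ _ => hnn j
      intro j hj
      simp only [Finset.mem_image, Finset.mem_filter, Finset.mem_range] at hj ⊢
      omega
    · intro x hx y hy hxy
      simp only [Finset.coe_filter, Finset.mem_range, Set.mem_ofPred_eq] at hx hy hxy
      omega
  · rw [Fin.sum_univ_eq_sum_range
      (fun i' => if (i : ℕ) ≤ i' then (1 + ((i' - (i : ℕ) : ℕ) : ℝ)) ^ (-γ) else 0),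
      ← Finset.sum_filter, ← Finset.sum_image (f := fun j : ℕ => (1 + (j : ℝ)) ^ (-γ))
        (g := fun i' => i' - (i : ℕ))]
    · refine Finset.sum_le_sum_of_subset_of_nonneg ?_ fun j _ _ => hnn j
      intro j hj
      simp only [Finset.mem_image, Finset.mem_filter, Finset.mem_range] at hj ⊢
      omega
    · intro x hx y hy hxy
      simp only [Finset.coe_filter, Finset.mem_range, Set.mem_ofPred_eq] at hx hy hxy
      omega

theorem finsum_mul_eq_sum_Icc {a : ℤ → ℝ} {R : ℕ} (ha : ∀ j, a j ≠ 0 → 0 ≤ j ∧ j ≤ R)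
    (f : ℤ → ℝ) : ∑ᶠ j, a j * f j = ∑ j ∈ Finset.Icc 0 (R : ℤ), a j * f j := by
  refine finsum_eq_sum_of_support_subset _ fun j hj => ?_
  exact Finset.mem_coe.2 (Finset.mem_Icc.2 (ha j (left_ne_zero_of_mul hj)))

theorem seqConv_eq_zero {a a' : ℤ → ℝ} {R : ℕ} (ha : ∀ j, a j ≠ 0 → 0 ≤ j ∧ j ≤ R)
    (ha' : ∀ j, a' j ≠ 0 → 0 ≤ j ∧ j ≤ R) {m : ℤ} (hm : m ∉ Finset.Icc (-(R : ℤ)) R) :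
    seqConv a a' m = 0 := by
  unfold seqConv
  refine (finsum_congr fun j => ?_).trans finsum_zero
  by_contra h
  have h1 := ha j (left_ne_zero_of_mul h)
  have h2 := ha' _ (right_ne_zero_of_mul h)
  exact hm (Finset.mem_Icc.2 ⟨by omega, by omega⟩)

theorem finsum_seqConv_mul {a a' : ℤ → ℝ} {R : ℕ} (ha : ∀ j, a j ≠ 0 → 0 ≤ j ∧ j ≤ R)
    (ha' : ∀ j, a' j ≠ 0 → 0 ≤ j ∧ j ≤ R) (f : ℤ → ℝ) :
    ∑ᶠ m, seqConv a a' m * f m = ∑ m ∈ Finset.Icc (-(R : ℤ)) R, seqConv a a' m * f m := by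
  refine finsum_eq_sum_of_support_subset _ fun m hm => ?_
  by_contra h
  exact left_ne_zero_of_mul hm (seqConv_eq_zero ha ha' h)

/-- The order of a convolution is at least the sum of the orders. -/
theorem sum_seqConv_mul_pow_eq_zero {a a' : ℤ → ℝ} {R M M' : ℕ}
    (ha : ∀ j, a j ≠ 0 → 0 ≤ j ∧ j ≤ R) (ha' : ∀ j, a' j ≠ 0 → 0 ≤ j ∧ j ≤ R)
    (hM : ∀ e < M, ∑ᶠ j, a j * (j : ℝ) ^ e = 0) (hM' : ∀ e < M', ∑ᶠ j, a' j * (j : ℝ) ^ e = 0)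
    {e : ℕ} (he : e < M + M') :
    ∑ m ∈ Finset.Icc (-(R : ℤ)) R, seqConv a a' m * (m : ℝ) ^ e = 0 := by
  have hinner : ∀ j ∈ Finset.Icc 0 (R : ℤ), ∑ m ∈ Finset.Icc (-(R : ℤ)) R, a' (j - m) * (m : ℝ) ^ e
      = ∑ l ∈ Finset.Icc 0 (R : ℤ), a' l * ((j : ℝ) - l) ^ e := by
    intro j hj
    rw [Finset.mem_Icc] at hj
    have h1 : ∑ m ∈ Finset.Icc (-(R : ℤ)) R, a' (j - m) * (m : ℝ) ^ e
        = ∑ᶠ m : ℤ, a' (j - m) * (m : ℝ) ^ e := by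
      refine (finsum_eq_sum_of_support_subset _ fun m hm => ?_).symm
      have := ha' _ (left_ne_zero_of_mul hm)
      exact Finset.mem_coe.2 (Finset.mem_Icc.2 ⟨by omega, by omega⟩)
    rw [h1, ← finsum_mul_eq_sum_Icc ha', ← finsum_comp_equiv (Equiv.subLeft j)]
    exact finsum_congr fun m => by simp [Equiv.subLeft]
  have hconv : ∀ m, seqConv a a' m = ∑ j ∈ Finset.Icc 0 (R : ℤ), a j * a' (j - m) := fun m =>
    finsum_mul_eq_sum_Icc ha fun j => a' (j - m)
  calc ∑ m ∈ Finset.Icc (-(R : ℤ)) R, seqConv a a' m * (m : ℝ) ^ e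
      = ∑ j ∈ Finset.Icc 0 (R : ℤ), a j
          * ∑ m ∈ Finset.Icc (-(R : ℤ)) R, a' (j - m) * (m : ℝ) ^ e := by
        simp_rw [hconv, Finset.sum_mul, Finset.mul_sum]
        rw [Finset.sum_comm]
        simp_rw [mul_assoc]
    _ = ∑ j ∈ Finset.Icc 0 (R : ℤ), a j * ∑ l ∈ Finset.Icc 0 (R : ℤ), a' l * ((j : ℝ) - l) ^ e :=
        Finset.sum_congr rfl fun j hj => by rw [hinner j hj]
    _ = ∑ t ∈ Finset.range (e + 1), (∑ j ∈ Finset.Icc 0 (R : ℤ), a j * (j : ℝ) ^ t)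
          * (∑ l ∈ Finset.Icc 0 (R : ℤ), a' l * (l : ℝ) ^ (e - t))
          * ((-1) ^ (e - t) * (e.choose t : ℝ)) := by
        simp_rw [Finset.sum_mul_sum, sub_eq_add_neg, add_pow, Finset.mul_sum, Finset.sum_mul]
        conv_rhs => rw [Finset.sum_comm]
        refine Finset.sum_congr rfl fun j _ => ?_
        rw [Finset.sum_comm]
        refine Finset.sum_congr rfl fun t _ => Finset.sum_congr rfl fun l _ => ?_
        rw [neg_pow (l : ℝ)]
        ring
    _ = 0 := by
        refine Finset.sum_eq_zero fun t ht => ?_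
        rw [Finset.mem_range] at ht
        rw [← finsum_mul_eq_sum_Icc ha, ← finsum_mul_eq_sum_Icc ha']
        rcases lt_or_ge t M with h | h
        · rw [hM t h, zero_mul, zero_mul]
        · rw [hM' (e - t) (by omega), mul_zero, zero_mul]

/-- joint central limit theorem for the quadratic `a^{(p)}`-variations,
`p = 1,…,k`: under (H0)–(H2), if the normalized covariance matrix converges to an
invertible matrix `Λ∞`, then the vector `((V_{a^{(p)},n} − E[V_{a^{(p)},n}])/(n^{1/2} δ_n^{2D+s}))_p`
converges in distribution to `N(0,Λ∞)`. -/
theorem stmt_10 (V r : ℝ → ℝ) (D : ℕ) (C s α : ℝ)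
    (hC : 0 < C) (hs0 : 0 < s) (hs2 : s < 2) (hα0 : 0 < α) (hα1 : α ≤ 1)
    -- (H0)
    (hEven : ∀ h : ℝ, V (-h) = V h) (hSmooth : ContDiffOn ℝ (⊤ : ℕ∞) V (Set.Ioi 0))
    -- (H1)
    (hV2D : ContDiff ℝ ((2 * D : ℕ) : ℕ∞) V)
    (hExp : ∀ h : ℝ, iteratedDeriv (2 * D) V h
      = iteratedDeriv (2 * D) V 0 + C * (-1 : ℝ) ^ D * |h| ^ s + r h)
    (hro : r =o[nhds (0:ℝ)] fun h => |h| ^ s)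
    -- (H2), with d = 2 if s < 3/2 and d = 3 otherwise
    (hrd : ContDiffOn ℝ ((if s < 3/2 then 2 else 3 : ℕ) : ℕ∞) r {(0:ℝ)}ᶜ)
    (hH2 : ∃ β K : ℝ, s - (if s < 3/2 then 2 else 3 : ℕ) < β ∧ β < -(1/2) ∧ 0 < K ∧
      (∀ h : ℝ, h ≠ 0 → |iteratedDeriv (if s < 3/2 then 2 else 3 : ℕ) r h| ≤ K * |h| ^ β) ∧
      (∀ h : ℝ, 1 < |h| → |r h| ≤ K * |h| ^ s))
    -- k variation sequences a^{(p)}, of length Ls p and order Ms p > D + s/2 + 1/4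
    (k : ℕ) (hk : 1 ≤ k) (aa : Fin k → ℤ → ℝ) (Ls Ms : Fin k → ℕ)
    (hL : ∀ p, 1 ≤ Ls p) (hM : ∀ p, 1 ≤ Ms p)
    (hsupp : ∀ p, ∀ j : ℤ, aa p j ≠ 0 → 0 ≤ j ∧ j ≤ (Ls p : ℤ) - 1)
    (ha0 : ∀ p, aa p 0 ≠ 0) (haL : ∀ p, aa p ((Ls p : ℤ) - 1) ≠ 0)
    (hmom : ∀ p, ∀ kk : ℕ, kk < Ms p → ∑ᶠ j : ℤ, aa p j * (j : ℝ) ^ kk = 0)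
    (hmomM : ∀ p, ∑ᶠ j : ℤ, aa p j * (j : ℝ) ^ (Ms p) ≠ 0)
    (hMD : ∀ p, (D : ℝ) + s / 2 + 1 / 4 < Ms p)
    -- jointly Gaussian variables Δ^{(p)}_i realized as A_n G_n, with the prescribed
    -- block covariance
    (A : (n : ℕ) → Matrix (Fin k × Fin n) (Fin k × Fin n) ℝ)
    (hA : ∀ n : ℕ, ∀ p q : Fin k, ∀ i i' : Fin n,
      (A n * (A n)ᵀ) (p, i) (q, i')
        = -∑ᶠ m : ℤ, seqConv (aa p) (aa q) m * V (((i : ℤ) - (i' : ℤ) + m) * (n : ℝ) ^ (-α)))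
    -- convergence of the normalized covariance matrix to an invertible matrix Λ∞
    (Λ : Matrix (Fin k) (Fin k) ℝ) (hΛinv : IsUnit Λ.det)
    (hΛ : ∀ p q : Fin k,
      Tendsto (fun n : ℕ =>
          covVP k n Ls (A n) p q / ((n : ℝ) * ((n : ℝ) ^ (-α)) ^ (4 * (D : ℝ) + 2 * s)))
        atTop (nhds (Λ p q)))
    -- a square root of Λ∞, realizing the limiting Gaussian distribution N(0,Λ∞)
    (B : Matrix (Fin k) (Fin k) ℝ) (hB : B * Bᵀ = Λ) :
    -- conclusion: convergence in distribution to N(0,Λ∞)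
    ∀ g : BoundedContinuousFunction (Fin k → ℝ) ℝ,
      Tendsto (fun n : ℕ =>
          ∫ z, g (fun p => (quadVarP k n Ls p z - expVP k n Ls (A n) p)
              / ((n : ℝ) ^ ((1 : ℝ) / 2) * ((n : ℝ) ^ (-α)) ^ (2 * (D : ℝ) + s)))
            ∂(gaussVec (A n)))
        atTop (nhds (∫ x, g x ∂(gaussVec B))) := by
  obtain ⟨β, K, hβ1, hβ2, hK0, hKd, hKs⟩ := hH2
  set d : ℕ := if s < 3 / 2 then 2 else 3 with hd
  have hd1 : 1 ≤ d := by rw [hd]; split_ifs <;> norm_num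
  have hsd : s - d < -(1 / 2) := by linarith
  have hord : ∀ p q, 2 * D + d ≤ Ms p + Ms q := by
    intro p q
    have hp := hMD p
    have hq := hMD q
    by_cases h : s < 3 / 2
    · have h1 : D < Ms p := by
        have : (D : ℝ) < Ms p := by linarith
        exact_mod_cast this
      have h2 : D < Ms q := by
        have : (D : ℝ) < Ms q := by linarith
        exact_mod_cast this
      rw [hd, if_pos h]
      omega
    · push Not at h
      have h1 : D + 1 < Ms p := by
        have : ((D + 1 : ℕ) : ℝ) < Ms p := by push_cast; linarith
        exact_mod_cast this
      have h2 : D + 1 < Ms q := by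
        have : ((D + 1 : ℕ) : ℝ) < Ms q := by push_cast; linarith
        exact_mod_cast this
      rw [hd, if_neg (not_lt.2 h)]
      omega
  have hrd' : ∀ y : ℝ, y ≠ 0 → ContDiffAt ℝ d r y := fun y hy => by
    simpa using hrd.contDiffAt (isOpen_compl_singleton.mem_nhds hy)
  obtain ⟨R, hR1, hsR⟩ : ∃ R : ℕ, 1 ≤ R ∧ ∀ p, ∀ j : ℤ, aa p j ≠ 0 → 0 ≤ j ∧ j ≤ R := by
    refine ⟨1 + ∑ p, Ls p, by omega, fun p j hj => ?_⟩
    have h1 := hsupp p j hj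
    have h2 : Ls p ≤ ∑ p, Ls p := Finset.single_le_sum (fun _ _ => Nat.zero_le _)
      (Finset.mem_univ p)
    omega
  set γ : ℝ := min (min (d - s) (-β)) (3 / 4) with hγ
  have hγh : 1 / 2 < γ := lt_min (lt_min (by linarith) (by linarith)) (by norm_num)
  have hγ1 : γ < 1 := (min_le_right _ _).trans_lt (by norm_num)
  have hγd : γ ≤ d - s := (min_le_left _ _).trans (min_le_left _ _)
  have hγβ : γ ≤ -β := (min_le_left _ _).trans (min_le_right _ _)
  have hbound : ∀ p q, ∃ K₀ : ℝ, 0 ≤ K₀ ∧ ∀ δ : ℝ, 0 < δ → δ ≤ 1 → ∀ j : ℤ,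
      |∑ᶠ m : ℤ, seqConv (aa p) (aa q) m * V ((j + m) * δ)|
        ≤ K₀ * (δ ^ (2 * (D : ℝ) + s) * (1 + |(j : ℝ)|) ^ (-γ)) := by
    intro p q
    have hm : ∀ e < Ms p + Ms q, ∑ m ∈ Finset.Icc (-(R : ℤ)) R,
        seqConv (aa p) (aa q) m * (m : ℝ) ^ e = 0 := fun e he =>
      sum_seqConv_mul_pow_eq_zero (hsR p) (hsR q) (hmom p) (hmom q) he
    obtain ⟨K₁, hK₁, h1⟩ := abs_sum_mul_variogram_le_of_far hEven hSmooth hExp hd1 hrd' hKd hK0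
      (by linarith) hγd hγβ hβ1.le (hord p q) hR1 hm
    obtain ⟨K₂, hK₂, h2⟩ := abs_sum_mul_variogram_le_of_near hs0 (by exact_mod_cast hV2D) hExp hro
      hKs (by linarith : 0 ≤ γ) (by have := hord p q; omega) hR1 hm
    refine ⟨K₁ + K₂, by positivity, fun δ hδ hδ1 j => ?_⟩
    rw [finsum_seqConv_mul (hsR p) (hsR q) fun m => V ((j + m) * δ), add_mul]
    have hpos : 0 ≤ δ ^ (2 * (D : ℝ) + s) * (1 + |(j : ℝ)|) ^ (-γ) := by positivity
    rcases le_total (2 * (R : ℝ)) |(j : ℝ)| with h | h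
    · exact (h1 δ hδ hδ1 j h).trans (le_add_of_nonneg_right (mul_nonneg hK₂ hpos))
    · exact (h2 δ hδ j h).trans (le_add_of_nonneg_left (mul_nonneg hK₁ hpos))
  choose K₀ hK₀ hbd using hbound
  have hnα : ∀ n : ℕ, 1 ≤ n → 0 < (n : ℝ) ^ (-α) ∧ (n : ℝ) ^ (-α) ≤ 1 := fun n hn => by
    have hn' : (1 : ℝ) ≤ n := by exact_mod_cast hn
    exact ⟨by positivity, Real.rpow_le_one_of_one_le_of_nonpos hn' (by linarith)⟩
  refine tendsto_integral_quadVarP_of_row_sum k Ls A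
    (fun n => (n : ℝ) ^ ((1 : ℝ) / 2) * ((n : ℝ) ^ (-α)) ^ (2 * (D : ℝ) + s))
    (fun n => (∑ p, ∑ q, K₀ p q) * (2 / (1 - γ)) * (n : ℝ) ^ (1 / 2 - γ)) ?_ ?_ ?_ Λ B hB ?_
  · filter_upwards [eventually_ge_atTop 1] with n hn
    have hn' : (0 : ℝ) < n := by exact_mod_cast hn
    positivity
  · have h := (tendsto_rpow_neg_atTop (by linarith : 0 < γ - 1 / 2)).comp
      (tendsto_natCast_atTop_atTop (R := ℝ))
    simp only [neg_sub] at h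
    simpa using h.const_mul ((∑ p, ∑ q, K₀ p q) * (2 / (1 - γ)))
  · filter_upwards [eventually_ge_atTop 1] with n hn
    rintro ⟨p, i⟩
    have hn' : (0 : ℝ) < n := by exact_mod_cast hn
    obtain ⟨hδ, hδ1⟩ := hnα n hn
    set δ := (n : ℝ) ^ (-α)
    calc ∑ y, |(A n * (A n)ᵀ) (p, i) y|
        = ∑ q, ∑ i', |(A n * (A n)ᵀ) (p, i) (q, i')| := Fintype.sum_prod_type _
      _ ≤ ∑ q, K₀ p q * (δ ^ (2 * (D : ℝ) + s) * (2 * ((n : ℝ) ^ (1 - γ) / (1 - γ)))) := by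
          refine Finset.sum_le_sum fun q _ => ?_
          refine (Finset.sum_le_sum fun i' _ => ?_).trans
            ((Finset.mul_sum _ _ _).symm.trans_le (mul_le_mul_of_nonneg_left
              ((Finset.mul_sum _ _ _).symm.trans_le (mul_le_mul_of_nonneg_left
                (sum_fin_one_add_abs_sub_rpow_neg_le (by linarith) hγ1 i) (by positivity)))
                (hK₀ p q)))
          rw [hA, abs_neg]
          have := hbd p q δ hδ hδ1 ((i : ℤ) - (i' : ℤ))
          push_cast at this ⊢
          exact this
      _ = (∑ q, K₀ p q) * (δ ^ (2 * (D : ℝ) + s) * (2 * ((n : ℝ) ^ (1 - γ) / (1 - γ)))) :=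
          (Finset.sum_mul _ _ _).symm
      _ ≤ (∑ p, ∑ q, K₀ p q) * (δ ^ (2 * (D : ℝ) + s) * (2 * ((n : ℝ) ^ (1 - γ) / (1 - γ)))) := by
          have h1γ : 0 < 1 - γ := by linarith
          refine mul_le_mul_of_nonneg_right ?_ (by positivity)
          exact Finset.single_le_sum (f := fun p => ∑ q, K₀ p q)
            (fun p _ => Finset.sum_nonneg fun q _ => hK₀ p q) (Finset.mem_univ p)
      _ = _ := by
          rw [show (1 : ℝ) - γ = (1 / 2 - γ) + 1 / 2 by ring, Real.rpow_add hn']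
          ring
  · intro p q
    refine (hΛ p q).congr fun n => ?_
    congr 1
    have h1 : ((n : ℝ) ^ ((1 : ℝ) / 2)) ^ 2 = n := by
      rw [← Real.rpow_natCast, ← Real.rpow_mul (by positivity)]
      norm_num
    have h2 : (((n : ℝ) ^ (-α)) ^ (2 * (D : ℝ) + s)) ^ 2
        = ((n : ℝ) ^ (-α)) ^ (4 * (D : ℝ) + 2 * s) := by
      rw [← Real.rpow_natCast (((n : ℝ) ^ (-α)) ^ (2 * (D : ℝ) + s)),
        ← Real.rpow_mul (x := (n : ℝ) ^ (-α)) (by positivity)]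
      congr 1
      push_cast
      ring
    rw [mul_pow, h1, h2]
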